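/- Let (S,F,μ) be a CP-measure space with barycenter T ∈ CP(X,M), and ν a finite positive measure equivalent to ρ∘μ for a normal faithful state ρ on M. Then for every f ∈ L^∞(ν) there is a unique operator κ_μ(f) ∈ π_T(X)′ such that ρ'(V_T* κ_μ(f) π_T(x) V_T) = ∫ f(s) d(ρ'(μ(s,x))) for all normal functionals ρ' on M and x ∈ X, and ‖κ_μ(f)‖ ≤ ‖f‖_∞. -/

import Mathlib

open scoped ComplexOrder InnerProductSpace

noncomputable section

/-- A matrix over a star ring is positive if it is of the form `Nᴴ * N`. -/
def MatPos {A : Type*} [Ring A] [StarRing A] {n : ℕ}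
    (M : Matrix (Fin n) (Fin n) A) : Prop :=
  ∃ N : Matrix (Fin n) (Fin n) A, M = N.conjTranspose * N

/-- `T` is completely positive if the induced entrywise maps on matrices are positive. -/
def CompletelyPositiveFun {A B : Type*} [Ring A] [StarRing A] [Ring B] [StarRing B]
    (T : A → B) : Prop :=
  ∀ (n : ℕ) (M : Matrix (Fin n) (Fin n) A), MatPos M → MatPos (M.map T)

/-- `(π, K, V)` is a Stinespring representation of `T : X → B(H)`:
`T x = V* (π x) V` for all `x`. -/
def IsStinespring {X : Type*} [NormedRing X] [StarRing X] [CStarRing X]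
    [NormedAlgebra ℂ X] [StarModule ℂ X]
    {H K : Type*} [NormedAddCommGroup H] [InnerProductSpace ℂ H] [CompleteSpace H]
    [NormedAddCommGroup K] [InnerProductSpace ℂ K] [CompleteSpace K]
    (T : X → (H →L[ℂ] H)) (π : X →⋆ₐ[ℂ] (K →L[ℂ] K)) (V : H →L[ℂ] K) : Prop :=
  ∀ x : X, T x = (ContinuousLinearMap.adjoint V).comp ((π x).comp V)

/-- Minimality: the closed linear span of `π(X) V H` is all of `K`. -/
def IsMinimalStinespring {X : Type*} [NormedRing X] [StarRing X] [CStarRing X]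
    [NormedAlgebra ℂ X] [StarModule ℂ X]
    {H K : Type*} [NormedAddCommGroup H] [InnerProductSpace ℂ H] [CompleteSpace H]
    [NormedAddCommGroup K] [InnerProductSpace ℂ K] [CompleteSpace K]
    (π : X →⋆ₐ[ℂ] (K →L[ℂ] K)) (V : H →L[ℂ] K) : Prop :=
  (Submodule.span ℂ {k : K | ∃ (x : X) (h : H), k = π x (V h)}).topologicalClosure = ⊤

open MeasureTheory

section CPMeasure

variable {X : Type*} [NormedRing X] [StarRing X] [CStarRing X]
  [NormedAlgebra ℂ X] [StarModule ℂ X]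
variable {H K : Type*} [NormedAddCommGroup H] [InnerProductSpace ℂ H] [CompleteSpace H]
  [NormedAddCommGroup K] [InnerProductSpace ℂ K] [CompleteSpace K]
variable {S : Type*} [MeasurableSpace S]

/-- `μ` is a CP-measure on `(S, F)` with values in the von Neumann algebra `M`:
each `μ(Δ)` is a CP map from `X` into `M`, and `μ` is countably additive in the weak
sense (against all vector functionals, hence against all normal functionals). -/
def IsCPMeasure (M : VonNeumannAlgebra H) (μ : Set S → X → (H →L[ℂ] H)) : Prop :=
  (∀ Δ : Set S, MeasurableSet Δ →
      IsLinearMap ℂ (μ Δ) ∧ CompletelyPositiveFun (μ Δ) ∧ ∀ x : X, μ Δ x ∈ M) ∧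
  (∀ Δ : ℕ → Set S, (∀ i, MeasurableSet (Δ i)) → Pairwise (Function.onFun Disjoint Δ) →
    ∀ (x : X) (ξ η : H), ⟪ξ, μ (⋃ i, Δ i) x η⟫_ℂ = ∑' i, ⟪ξ, μ (Δ i) x η⟫_ℂ)

/-- The sequence `e` with `∑ ‖e n‖² = 1` determines the normal state
`ρ(A) = ∑ₙ ⟨e n, A (e n)⟩` on `B(H)`; faithfulness on `M` is required. -/
def IsNormalFaithfulStateOn (M : VonNeumannAlgebra H) (e : ℕ → H) : Prop :=
  (∑' n, (‖e n‖ : ℝ) ^ 2 = 1) ∧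
  ∀ A : H →L[ℂ] H, A ∈ M → A.IsPositive → (∑' n, ⟪e n, A (e n)⟫_ℂ) = 0 → A = 0

/-- `ν` is equivalent (mutually absolutely continuous) to the scalar measure
`ρ ∘ μ : Δ ↦ ∑ₙ ⟨e n, μ(Δ)(1) (e n)⟩`. -/
def IsEquivalentBaseMeasure (μ : Set S → X → (H →L[ℂ] H)) (e : ℕ → H)
    (ν : Measure S) : Prop :=
  ∀ Δ : Set S, MeasurableSet Δ → (ν Δ = 0 ↔ (∑' n, ⟪e n, μ Δ 1 (e n)⟫_ℂ) = 0)

/-- `R` satisfies the defining property of `κ_μ(f)`: for every vector functional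
`⟨ξ, · η⟩`, every `x ∈ X`, and every `ν`-density `g` of the complex measure
`Δ ↦ ⟨ξ, μ(Δ)(x) η⟩`, one has `⟨ξ, (V* R π(x) V) η⟩ = ∫ f g dν`, i.e. weakly
`V* R π(x) V = ∫ f(s) dμ(s, x)`. -/
def IsKappa (μ : Set S → X → (H →L[ℂ] H)) (ν : Measure S)
    (π : X →⋆ₐ[ℂ] (K →L[ℂ] K)) (V : H →L[ℂ] K) (f : S → ℂ) (R : K →L[ℂ] K) : Prop :=
  ∀ (x : X) (ξ η : H) (g : S → ℂ), Integrable g ν →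
    (∀ Δ : Set S, MeasurableSet Δ → ⟪ξ, μ Δ x η⟫_ℂ = ∫ s in Δ, g s ∂ν) →
    ⟪ξ, ((ContinuousLinearMap.adjoint V).comp (R.comp ((π x).comp V))) η⟫_ℂ
      = ∫ s, f s * g s ∂ν

end CPMeasure

open Filter Topology

/-- Radon–Nikodym for a countably additive complex set function that vanishes on null sets. -/
theorem exists_integrable_density {S : Type*} [MeasurableSpace S] (ν : Measure S)
    [IsFiniteMeasure ν] (m : Set S → ℂ)
    (hm : ∀ Δ : ℕ → Set S, (∀ i, MeasurableSet (Δ i)) → Pairwise (Function.onFun Disjoint Δ) →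
      HasSum (fun i => m (Δ i)) (m (⋃ i, Δ i)))
    (hac : ∀ Δ, MeasurableSet Δ → ν Δ = 0 → m Δ = 0) :
    ∃ g : S → ℂ, Integrable g ν ∧ ∀ Δ, MeasurableSet Δ → m Δ = ∫ s in Δ, g s ∂ν := by
  classical
  have key : ∀ φ : ℂ →L[ℝ] ℝ, ∃ g : S → ℝ, Integrable g ν ∧
      ∀ Δ, MeasurableSet Δ → φ (m Δ) = ∫ s in Δ, g s ∂ν := by
    intro φ
    let σ : SignedMeasure S :=
      { measureOf' := fun Δ => if MeasurableSet Δ then φ (m Δ) else 0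
        empty' := by simp [hac ∅ MeasurableSet.empty]
        not_measurable' := fun Δ h => if_neg h
        m_iUnion' := fun Δ h1 h2 => by
          simp only [h1, MeasurableSet.iUnion h1, if_true]
          exact φ.hasSum (hm Δ h1 h2) }
    have hσ : ∀ Δ, MeasurableSet Δ → σ Δ = φ (m Δ) := fun Δ h => if_pos h
    have hσν : σ ≪ᵥ ν.toENNRealVectorMeasure := by
      refine VectorMeasure.AbsolutelyContinuous.mk fun Δ hΔ h0 => ?_
      rw [Measure.toENNRealVectorMeasure_apply_measurable hΔ] at h0
      rw [hσ Δ hΔ, hac Δ hΔ h0, map_zero]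
    refine ⟨σ.rnDeriv ν, SignedMeasure.integrable_rnDeriv σ ν, fun Δ hΔ => ?_⟩
    rw [← hσ Δ hΔ, ← withDensityᵥ_apply (SignedMeasure.integrable_rnDeriv σ ν) hΔ,
      SignedMeasure.withDensityᵥ_rnDeriv_eq σ ν hσν]
  obtain ⟨u, hu, hu'⟩ := key Complex.reCLM
  obtain ⟨v, hv, hv'⟩ := key Complex.imCLM
  refine ⟨fun s => u s + v s * Complex.I, hu.ofReal.add (hv.ofReal.mul_const _), fun Δ hΔ => ?_⟩
  rw [integral_add (μ := ν.restrict Δ) hu.ofReal.restrict (hv.ofReal.mul_const _).restrict,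
    integral_mul_const, integral_complex_ofReal, integral_complex_ofReal, ← hu' Δ hΔ, ← hv' Δ hΔ]
  exact (Complex.re_add_im (m Δ)).symm

/-- If `G` is dominated setwise by the geometric mean of two positive densities, then integration
against `G` is bounded by the essential supremum times the geometric mean of the total masses. -/
theorem norm_integral_mul_le_of_setIntegral_le {S : Type*} [MeasurableSpace S] {ν : Measure S}
    {G : S → ℂ} {P Q : S → ℝ} (hG : Integrable G ν) (hP : Integrable P ν) (hQ : Integrable Q ν)
    (hP0 : ∀ Δ, MeasurableSet Δ → 0 ≤ ∫ s in Δ, P s ∂ν)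
    (hQ0 : ∀ Δ, MeasurableSet Δ → 0 ≤ ∫ s in Δ, Q s ∂ν)
    (h : ∀ Δ, MeasurableSet Δ →
      ‖∫ s in Δ, G s ∂ν‖ ≤ √(∫ s in Δ, P s ∂ν) * √(∫ s in Δ, Q s ∂ν))
    {f : S → ℂ} (hf : Measurable f) {C : ℝ} (hC : 0 ≤ C) (hfC : ∀ᵐ s ∂ν, ‖f s‖ ≤ C) :
    ‖∫ s, f s * G s ∂ν‖ ≤ C * (√(∫ s, P s ∂ν) * √(∫ s, Q s ∂ν)) := by
  classical
  have hsum : ∀ (φ : SimpleFunc S ℂ) (W : S → ℝ), Integrable W ν →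
      ∑ y ∈ φ.range, ∫ s in φ ⁻¹' {y}, W s ∂ν = ∫ s, W s ∂ν := by
    intro φ W hW
    rw [← integral_biUnion_finset φ.range (fun y _ => φ.measurableSet_preimage {y})
      (fun y _ z _ hyz => Disjoint.preimage _ (by simpa using hyz))
      (fun y _ => hW.integrableOn)]
    have : (⋃ y ∈ φ.range, φ ⁻¹' {y}) = Set.univ := by
      ext s; simp
    rw [this, Measure.restrict_univ]
  have hsimple : ∀ φ : SimpleFunc S ℂ, (∀ s, ‖φ s‖ ≤ C) →
      ‖∫ s, φ s * G s ∂ν‖ ≤ C * (√(∫ s, P s ∂ν) * √(∫ s, Q s ∂ν)) := by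
    intro φ hφ
    have hpt : ∀ s, φ s * G s = ∑ y ∈ φ.range, (φ ⁻¹' {y}).indicator (fun s => y * G s) s := by
      intro s
      rw [Finset.sum_eq_single (φ s)]
      · simp
      · intro y _ hy
        exact Set.indicator_of_notMem (by simpa using fun h => hy h.symm) _
      · intro hs; exact absurd (φ.mem_range_self s) hs
    simp_rw [hpt]
    rw [integral_finsetSum _ fun y _ =>
      (hG.const_mul y).indicator (φ.measurableSet_preimage {y})]
    simp_rw [integral_indicator (φ.measurableSet_preimage _), integral_const_mul]
    calc ‖∑ y ∈ φ.range, y * ∫ s in φ ⁻¹' {y}, G s ∂ν‖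
        ≤ ∑ y ∈ φ.range, C * (√(∫ s in φ ⁻¹' {y}, P s ∂ν) * √(∫ s in φ ⁻¹' {y}, Q s ∂ν)) := by
          refine norm_sum_le_of_le _ fun y hy => ?_
          rw [norm_mul]
          obtain ⟨s, rfl⟩ := SimpleFunc.mem_range.1 hy
          exact mul_le_mul (hφ s) (h _ (φ.measurableSet_preimage _)) (norm_nonneg _) hC
      _ ≤ _ := by
          rw [← Finset.mul_sum, ← hsum φ P hP, ← hsum φ Q hQ]
          exact mul_le_mul_of_nonneg_left (Real.sum_sqrt_mul_sqrt_le _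
            (fun y => hP0 _ (φ.measurableSet_preimage _))
            (fun y => hQ0 _ (φ.measurableSet_preimage _))) hC
  let B : Set ℂ := Metric.closedBall 0 C
  have h0 : (0 : ℂ) ∈ B := by simpa [B] using hC
  let φ : ℕ → SimpleFunc S ℂ := SimpleFunc.approxOn f hf B 0 h0
  have hφ : ∀ n s, ‖φ n s‖ ≤ C := fun n s => by
    simpa [B] using SimpleFunc.approxOn_mem hf h0 n s
  have hlim : Tendsto (fun n => ∫ s, φ n s * G s ∂ν) atTop (𝓝 (∫ s, f s * G s ∂ν)) := by
    refine tendsto_integral_of_dominated_convergence (fun s => C * ‖G s‖)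
      (fun n => (φ n).aestronglyMeasurable.mul hG.aestronglyMeasurable)
      (hG.norm.const_mul C)
      (fun n => Eventually.of_forall fun s => by
        rw [norm_mul]; exact mul_le_mul_of_nonneg_right (hφ n s) (norm_nonneg _)) ?_
    filter_upwards [hfC] with s hs
    refine Tendsto.mul_const _ (SimpleFunc.tendsto_approxOn hf h0 (subset_closure ?_))
    simpa [B] using hs
  exact le_of_tendsto hlim.norm (Eventually.of_forall fun n => hsimple (φ n) (hφ n))

theorem inner_sum_smul_sum_smul {ι ι' E : Type*} [NormedAddCommGroup E] [InnerProductSpace ℂ E]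
    (t : Finset ι) (t' : Finset ι') (a : ι → ℂ) (a' : ι' → ℂ) (v : ι → E) (w : ι' → E) :
    ⟪∑ p ∈ t, a p • v p, ∑ q ∈ t', a' q • w q⟫_ℂ =
      ∑ p ∈ t, ∑ q ∈ t', starRingEnd ℂ (a p) * a' q * ⟪v p, w q⟫_ℂ := by
  rw [sum_inner]
  refine Finset.sum_congr rfl fun p _ => ?_
  rw [inner_smul_left, inner_sum, Finset.mul_sum]
  refine Finset.sum_congr rfl fun q _ => ?_
  rw [inner_smul_right, mul_assoc]

/-- A kernel on a total family `L` that is bounded as a sesquilinear form is given by a bounded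
operator. -/
theorem exists_clm_of_bounded_kernel {ι K : Type*} [NormedAddCommGroup K]
    [InnerProductSpace ℂ K] [CompleteSpace K] (L : ι → K)
    (hL : (Submodule.span ℂ (Set.range L)).topologicalClosure = ⊤) (b : ι → ι → ℂ) {C : ℝ}
    (hC : 0 ≤ C)
    (hb : ∀ (t : Finset ι) (a a' : ι → ℂ),
      ‖∑ p ∈ t, ∑ q ∈ t, starRingEnd ℂ (a p) * a' q * b p q‖
        ≤ C * (‖∑ p ∈ t, a p • L p‖ * ‖∑ q ∈ t, a' q • L q‖)) :
    ∃ R : K →L[ℂ] K, ‖R‖ ≤ C ∧ ∀ p q, ⟪L p, R (L q)⟫_ℂ = b p q := by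
  classical
  let Λ : (ι →₀ ℂ) →ₗ[ℂ] K := Finsupp.linearCombination ℂ L
  have hdense : DenseRange Λ := by
    have : (LinearMap.range Λ).topologicalClosure = ⊤ := by
      rw [Finsupp.range_linearCombination]; exact hL
    exact (Submodule.dense_iff_topologicalClosure_eq_top.2 this)
  have hb' : ∀ a a' : ι →₀ ℂ,
      ‖a.sum fun p c => a'.sum fun q d => starRingEnd ℂ c * d * b p q‖
        ≤ C * (‖Λ a‖ * ‖Λ a'‖) := by
    intro a a'
    have h := hb (a.support ∪ a'.support) a a'
    have e1 : ∀ c : ι →₀ ℂ, c.support ⊆ a.support ∪ a'.support →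
        Λ c = ∑ p ∈ a.support ∪ a'.support, c p • L p := fun c hc => by
      simp only [Λ, Finsupp.linearCombination_apply]
      exact Finsupp.sum_of_support_subset _ hc _ (by simp)
    rw [e1 a Finset.subset_union_left, e1 a' Finset.subset_union_right]
    convert h using 2
    rw [Finsupp.sum_of_support_subset _ Finset.subset_union_left _ (by simp)]
    refine Finset.sum_congr rfl fun p _ => ?_
    rw [Finsupp.sum_of_support_subset _ Finset.subset_union_right _ (by simp)]
  have hcol : ∀ q, ∃ r : K, ∀ p, ⟪L p, r⟫_ℂ = b p q := by
    intro q
    let ℓ : (ι →₀ ℂ) →ₗ[ℂ] ℂ := Finsupp.linearCombination ℂ fun p => starRingEnd ℂ (b p q)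
    have hℓ : ∀ a, ‖ℓ a‖ ≤ (C * ‖L q‖) * ‖Λ a‖ := by
      intro a
      have h := hb' a (Finsupp.single q 1)
      have e : ℓ a = starRingEnd ℂ (a.sum fun p c => (Finsupp.single q (1 : ℂ)).sum
          fun q d => starRingEnd ℂ c * d * b p q) := by
        simp [ℓ, Finsupp.linearCombination_apply, Finsupp.sum]
      rw [e, RCLike.norm_conj]
      calc _ ≤ _ := h
        _ = _ := by simp [Λ]; ring
    let φ : K →L[ℂ] ℂ := ℓ.extendOfNorm Λ
    refine ⟨(InnerProductSpace.toDual ℂ K).symm φ, fun p => ?_⟩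
    have hφ : φ (L p) = starRingEnd ℂ (b p q) := by
      have := LinearMap.extendOfNorm_eq (f := ℓ) hdense ⟨_, hℓ⟩ (Finsupp.single p 1)
      simpa [Λ, ℓ] using this
    rw [← inner_conj_symm, InnerProductSpace.toDual_symm_apply, hφ, Complex.conj_conj]
  choose r hr using hcol
  let Φ : (ι →₀ ℂ) →ₗ[ℂ] K := Finsupp.linearCombination ℂ r
  have hinner : ∀ a a', ⟪Λ a, Φ a'⟫_ℂ =
      a.sum fun p c => a'.sum fun q d => starRingEnd ℂ c * d * b p q := by
    intro a a'
    simp only [Λ, Φ, Finsupp.linearCombination_apply, Finsupp.sum]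
    rw [inner_sum_smul_sum_smul]
    simp only [hr]
  have hΦ : ∀ a', ‖Φ a'‖ ≤ C * ‖Λ a'‖ := by
    intro a'
    have hall : ∀ k : K, ‖⟪k, Φ a'⟫_ℂ‖ ≤ C * ‖Λ a'‖ * ‖k‖ := by
      refine fun k => hdense.induction_on (p := fun k => ‖⟪k, Φ a'⟫_ℂ‖ ≤ C * ‖Λ a'‖ * ‖k‖) k
        (isClosed_le (by fun_prop) (by fun_prop)) fun a => ?_
      rw [hinner]
      calc _ ≤ _ := hb' a a'
        _ = _ := by ring
    have h := hall (Φ a')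
    rw [inner_self_eq_norm_sq_to_K] at h
    rcases (norm_nonneg (Φ a')).eq_or_lt with h0 | h0
    · rw [← h0]; positivity
    · refine le_of_mul_le_mul_right ?_ h0
      simpa [sq] using h
  refine ⟨Φ.extendOfNorm Λ, LinearMap.opNorm_extendOfNorm_le hdense hC hΦ, fun p q => ?_⟩
  have h := LinearMap.extendOfNorm_eq (f := Φ) hdense ⟨C, hΦ⟩ (Finsupp.single q 1)
  have h' : Φ.extendOfNorm Λ (L q) = r q := by simpa [Λ, Φ] using h
  rw [h', hr]

/-- If the kernels `k Δ` are Gram kernels on finite sets and have densities `g`, then for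
`‖f‖ ≤ C` almost everywhere the kernel `∫ f g` is bounded by `C` with respect to any Gram
realization `L` of the total kernel. -/
theorem norm_sum_integral_mul_le {ι S H K : Type*} [MeasurableSpace S] {ν : Measure S}
    [NormedAddCommGroup H] [InnerProductSpace ℂ H] [NormedAddCommGroup K] [InnerProductSpace ℂ K]
    {k : Set S → ι → ι → ℂ} {g : ι → ι → S → ℂ} (hg : ∀ p q, Integrable (g p q) ν)
    (hk : ∀ p q Δ, MeasurableSet Δ → k Δ p q = ∫ s in Δ, g p q s ∂ν)
    (hgram : ∀ Δ, MeasurableSet Δ → ∀ t : Finset ι, ∃ (n : ℕ) (w : ι → PiLp 2 fun _ : Fin n => H),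
      ∀ p ∈ t, ∀ q ∈ t, ⟪w p, w q⟫_ℂ = k Δ p q)
    {L : ι → K} (hL : ∀ p q, ⟪L p, L q⟫_ℂ = k Set.univ p q)
    {f : S → ℂ} (hf : Measurable f) {C : ℝ} (hC : 0 ≤ C) (hfC : ∀ᵐ s ∂ν, ‖f s‖ ≤ C)
    (hfb : ∀ p q, Integrable (fun s => f s * g p q s) ν)
    (t : Finset ι) (a a' : ι → ℂ) :
    ‖∑ p ∈ t, ∑ q ∈ t, starRingEnd ℂ (a p) * a' q * ∫ s, f s * g p q s ∂ν‖
      ≤ C * (‖∑ p ∈ t, a p • L p‖ * ‖∑ q ∈ t, a' q • L q‖) := by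
  let G : (ι → ℂ) → (ι → ℂ) → S → ℂ := fun a a' s =>
    ∑ p ∈ t, ∑ q ∈ t, starRingEnd ℂ (a p) * a' q * g p q s
  have hG : ∀ a a', Integrable (G a a') ν := fun a a' =>
    integrable_finsetSum _ fun p _ => integrable_finsetSum _ fun q _ => (hg p q).const_mul _
  have hGk : ∀ a a' Δ, MeasurableSet Δ → ∫ s in Δ, G a a' s ∂ν =
      ∑ p ∈ t, ∑ q ∈ t, starRingEnd ℂ (a p) * a' q * k Δ p q := by
    intro a a' Δ hΔ
    simp only [G]
    rw [integral_finsetSum _ fun p _ => integrable_finsetSum _ fun q _ =>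
      ((hg p q).const_mul _).restrict]
    refine Finset.sum_congr rfl fun p _ => ?_
    rw [integral_finsetSum _ fun q _ => ((hg p q).const_mul _).restrict]
    refine Finset.sum_congr rfl fun q _ => ?_
    rw [integral_const_mul, hk p q Δ hΔ]
  have hre : ∀ a Δ, ∫ s in Δ, (G a a s).re ∂ν = (∫ s in Δ, G a a s ∂ν).re := fun a Δ =>
    integral_re (hG a a).restrict
  have hinner : ∀ Δ, MeasurableSet Δ → ∃ (n : ℕ) (u : (ι → ℂ) → PiLp 2 fun _ : Fin n => H),
      ∀ a a', ∫ s in Δ, G a a' s ∂ν = ⟪u a, u a'⟫_ℂ := by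
    intro Δ hΔ
    obtain ⟨n, w, hw⟩ := hgram Δ hΔ t
    refine ⟨n, fun a => ∑ p ∈ t, a p • w p, fun a a' => ?_⟩
    rw [hGk a a' Δ hΔ, inner_sum_smul_sum_smul]
    exact Finset.sum_congr rfl fun p hp => Finset.sum_congr rfl fun q hq => by rw [hw p hp q hq]
  have hnonneg : ∀ a Δ, MeasurableSet Δ → 0 ≤ ∫ s in Δ, (G a a s).re ∂ν := by
    intro a Δ hΔ
    obtain ⟨n, u, hu⟩ := hinner Δ hΔ
    rw [hre, hu]
    exact inner_self_nonneg (𝕜 := ℂ)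
  have htotal : ∀ a, √(∫ s, (G a a s).re ∂ν) = ‖∑ p ∈ t, a p • L p‖ := by
    intro a
    rw [← setIntegral_univ, hre, hGk a a _ MeasurableSet.univ,
      norm_eq_sqrt_re_inner (𝕜 := ℂ), inner_sum_smul_sum_smul]
    simp only [hL]
    rfl
  have hmain := norm_integral_mul_le_of_setIntegral_le (hG a a') (hG a a).re (hG a' a').re
    (hnonneg a) (hnonneg a') (fun Δ hΔ => by
      obtain ⟨n, u, hu⟩ := hinner Δ hΔ
      change _ ≤ √(∫ s in Δ, (G a a s).re ∂ν) * √(∫ s in Δ, (G a' a' s).re ∂ν)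
      rw [hre, hre, hu, hu, hu]
      have := norm_inner_le_norm (𝕜 := ℂ) (u a) (u a')
      rwa [norm_eq_sqrt_re_inner (𝕜 := ℂ) (u a), norm_eq_sqrt_re_inner (𝕜 := ℂ) (u a')] at this)
    hf hC hfC
  change _ ≤ C * (√(∫ s, (G a a s).re ∂ν) * √(∫ s, (G a' a' s).re ∂ν)) at hmain
  rw [htotal, htotal] at hmain
  convert hmain using 2
  have e : ∀ s, f s * G a a' s =
      ∑ p ∈ t, ∑ q ∈ t, starRingEnd ℂ (a p) * a' q * (f s * g p q s) := by
    intro s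
    simp only [G, Finset.mul_sum]
    exact Finset.sum_congr rfl fun p _ => Finset.sum_congr rfl fun q _ => by ring
  simp_rw [e]
  rw [integral_finsetSum _ fun p _ => integrable_finsetSum _ fun q _ => (hfb p q).const_mul _]
  refine Finset.sum_congr rfl fun p _ => ?_
  rw [integral_finsetSum _ fun q _ => (hfb p q).const_mul _]
  exact Finset.sum_congr rfl fun q _ => (integral_const_mul _ _).symm

/-- A nonnegative set function whose value on disjoint unions is the `tsum` of the values is
summable along disjoint sequences. -/
theorem summable_of_iUnion_eq_tsum {S : Type*} [MeasurableSpace S] {m : Set S → ℂ}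
    (hm : ∀ Δ : ℕ → Set S, (∀ i, MeasurableSet (Δ i)) → Pairwise (Function.onFun Disjoint Δ) →
      m (⋃ i, Δ i) = ∑' i, m (Δ i))
    (h0 : ∀ Δ, MeasurableSet Δ → 0 ≤ m Δ) (Δ : ℕ → Set S) (hΔ : ∀ i, MeasurableSet (Δ i))
    (hd : Pairwise (Function.onFun Disjoint Δ)) : Summable fun i => m (Δ i) := by
  classical
  have hempty : m ∅ = 0 := by
    have := hm (fun _ => ∅) (fun _ => MeasurableSet.empty) (fun _ _ _ => disjoint_bot_left)
    simpa using this
  have hbound : ∀ n, ∑ i ∈ Finset.range n, (m (Δ i)).re ≤ (m Set.univ).re := by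
    intro n
    let U : Set S := (⋃ j ∈ Finset.range n, Δ j)ᶜ
    have hU : MeasurableSet U := (Finset.measurableSet_biUnion _ fun j _ => hΔ j).compl
    have hUd : ∀ i < n, Disjoint (Δ i) U := fun i hi =>
      Set.disjoint_compl_right_iff_subset.2
        (Set.subset_biUnion_of_mem (u := Δ) (Finset.mem_coe.2 (Finset.mem_range.2 hi)))
    let D : ℕ → Set S := fun i => if i < n then Δ i else if i = n then U else ∅
    have hD : ∀ i, MeasurableSet (D i) := fun i => by
      simp only [D]; split_ifs
      exacts [hΔ i, hU, MeasurableSet.empty]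
    have hDd : Pairwise (Function.onFun Disjoint D) := by
      intro i j hij
      simp only [Function.onFun, D]
      split_ifs with h1 h2 h3 h4 h5 h6 <;> first
        | exact hd hij
        | exact hUd _ ‹_›
        | exact (hUd _ ‹_›).symm
        | exact disjoint_bot_left
        | exact disjoint_bot_right
        | omega
    have hDU : ⋃ i, D i = Set.univ := by
      refine Set.eq_univ_of_forall fun s => ?_
      by_cases hs : s ∈ U
      · exact Set.mem_iUnion.2 ⟨n, by simpa [D] using hs⟩
      · simp only [U, Set.mem_compl_iff, not_not, Set.mem_iUnion, Finset.mem_range] at hs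
        obtain ⟨i, hi, hs⟩ := hs
        exact Set.mem_iUnion.2 ⟨i, by simpa [D, hi] using hs⟩
    have h := hm D hD hDd
    rw [hDU, tsum_eq_sum (s := Finset.range (n + 1)) (fun i hi => by
      have : n < i := by simpa using hi
      simp only [D, if_neg (by omega : ¬ i < n), if_neg (by omega : ¬ i = n), hempty]),
      Finset.sum_range_succ] at h
    have hDn : D n = U := by simp [D]
    have hDi : ∑ i ∈ Finset.range n, m (D i) = ∑ i ∈ Finset.range n, m (Δ i) :=
      Finset.sum_congr rfl fun i hi => by simp only [D, if_pos (Finset.mem_range.1 hi)]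
    rw [h, hDn, hDi, Complex.add_re, Complex.re_sum]
    exact le_add_of_nonneg_right (Complex.nonneg_iff.1 (h0 U hU)).1
  have hs : Summable fun i => (m (Δ i)).re :=
    summable_of_sum_range_le (fun i => (Complex.nonneg_iff.1 (h0 _ (hΔ i))).1) hbound
  refine (Complex.hasSum_ofReal (f := fun i => (m (Δ i)).re).2 hs.hasSum).summable.congr
    fun i => ?_
  exact Complex.ext rfl (by simp [← (Complex.nonneg_iff.1 (h0 _ (hΔ i))).2])

section CompletelyPositive

variable {X H : Type*} [NormedRing X] [StarRing X]
  [NormedAddCommGroup H] [InnerProductSpace ℂ H] [CompleteSpace H]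

/-- The kernel `⟨h, T(x* y) h'⟩` of a completely positive map is a Gram kernel on finite sets. -/
theorem CompletelyPositiveFun.exists_gram {T : X → (H →L[ℂ] H)} (hT : CompletelyPositiveFun T)
    (t : Finset (X × H)) : ∃ (n : ℕ) (w : X × H → PiLp 2 fun _ : Fin n => H),
      ∀ p ∈ t, ∀ q ∈ t, ⟪w p, w q⟫_ℂ = ⟪p.2, T (star p.1 * q.1) q.2⟫_ℂ := by
  classical
  let n := t.card
  let ε : Fin n ≃ t := t.equivFin.symm
  let A : Matrix (Fin n) (Fin n) X := Matrix.of fun i j => star (ε i).1.1 * (ε j).1.1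
  have hA : MatPos A := by
    refine ⟨Matrix.of fun l j => if l.val = 0 then (ε j).1.1 else 0, ?_⟩
    ext i j
    have hn : 0 < n := i.pos
    rw [Matrix.mul_apply, Finset.sum_eq_single (⟨0, hn⟩ : Fin n)]
    · simp [A, Matrix.conjTranspose_apply]
    · intro l _ hl
      have : l.val ≠ 0 := fun h => hl (Fin.ext h)
      simp [this]
    · simp
  obtain ⟨N, hN⟩ := hT n A hA
  refine ⟨n, fun p => if hp : p ∈ t then WithLp.toLp 2 fun l => N l (ε.symm ⟨p, hp⟩) p.2 else 0,
    fun p hp q hq => ?_⟩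
  have h := congrFun (congrFun hN (ε.symm ⟨p, hp⟩)) (ε.symm ⟨q, hq⟩)
  simp only [A, Matrix.map_apply, Matrix.of_apply, Equiv.apply_symm_apply, Matrix.mul_apply,
    Matrix.conjTranspose_apply] at h
  simp only [dif_pos hp, dif_pos hq]
  rw [PiLp.inner_apply, h]
  simp [ContinuousLinearMap.star_eq_adjoint, ContinuousLinearMap.adjoint_inner_right]

theorem CompletelyPositiveFun.inner_nonneg {T : X → (H →L[ℂ] H)} (hT : CompletelyPositiveFun T)
    (x : X) (ξ : H) : 0 ≤ ⟪ξ, T (star x * x) ξ⟫_ℂ := by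
  obtain ⟨n, w, hw⟩ := hT.exists_gram {(x, ξ)}
  have h := hw (x, ξ) (by simp) (x, ξ) (by simp)
  rw [← h]
  rw [inner_self_eq_norm_sq_to_K, ← RCLike.ofReal_pow]
  exact Complex.zero_le_real.2 (sq_nonneg ‖w (x, ξ)‖)

theorem CompletelyPositiveFun.norm_inner_le {T : X → (H →L[ℂ] H)} (hT : CompletelyPositiveFun T)
    (x y : X) (ξ η : H) : ‖⟪ξ, T (star x * y) η⟫_ℂ‖ ≤
      √(⟪ξ, T (star x * x) ξ⟫_ℂ).re * √(⟪η, T (star y * y) η⟫_ℂ).re := by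
  classical
  obtain ⟨n, w, hw⟩ := hT.exists_gram {(x, ξ), (y, η)}
  have h1 := hw (x, ξ) (by simp) (y, η) (by simp)
  have h2 := hw (x, ξ) (by simp) (x, ξ) (by simp)
  have h3 := hw (y, η) (by simp) (y, η) (by simp)
  rw [← h1, ← h2, ← h3]
  have := norm_inner_le_norm (𝕜 := ℂ) (w (x, ξ)) (w (y, η))
  rwa [norm_eq_sqrt_re_inner (𝕜 := ℂ) (w (x, ξ)), norm_eq_sqrt_re_inner (𝕜 := ℂ) (w (y, η))]
    at this

end CompletelyPositive

theorem inner_map_apply_eq {X K : Type*} [NormedRing X] [StarRing X] [NormedAlgebra ℂ X]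
    [NormedAddCommGroup K] [InnerProductSpace ℂ K] [CompleteSpace K]
    (π : X →⋆ₐ[ℂ] (K →L[ℂ] K)) (x : X) (k k' : K) :
    ⟪π x k, k'⟫_ℂ = ⟪k, π (star x) k'⟫_ℂ := by
  rw [map_star, ContinuousLinearMap.star_eq_adjoint, ContinuousLinearMap.adjoint_inner_right]

/-- Operators agreeing weakly on a total family are equal. -/
theorem clm_ext_of_inner {ι K : Type*} [NormedAddCommGroup K] [InnerProductSpace ℂ K]
    {L : ι → K}
    (hL : (Submodule.span ℂ (Set.range L)).topologicalClosure = ⊤) {R R' : K →L[ℂ] K}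
    (h : ∀ p q, ⟪L p, R (L q)⟫_ℂ = ⟪L p, R' (L q)⟫_ℂ) : R = R' := by
  have hd := Submodule.dense_iff_topologicalClosure_eq_top.2 hL
  refine ContinuousLinearMap.ext_on hd ?_
  rintro _ ⟨q, rfl⟩
  refine hd.eq_of_inner_right (𝕜 := ℂ) fun k hk => ?_
  induction hk using Submodule.span_induction with
  | mem k hk => obtain ⟨p, rfl⟩ := hk; exact h p q
  | zero => simp
  | add k k' _ _ hk hk' => rw [inner_add_left, inner_add_left, hk, hk']
  | smul c k _ hk => rw [inner_smul_left, inner_smul_left, hk]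

section CPMeasure

variable {X : Type*} [NormedRing X] [StarRing X] [NormedAlgebra ℂ X]
variable {H K : Type*} [NormedAddCommGroup H] [InnerProductSpace ℂ H] [CompleteSpace H]
  [NormedAddCommGroup K] [InnerProductSpace ℂ K] [CompleteSpace K]
variable {S : Type*} [MeasurableSpace S]
variable {M : VonNeumannAlgebra H} {μ : Set S → X → (H →L[ℂ] H)}

theorem IsCPMeasure.completelyPositiveFun (hμ : IsCPMeasure M μ) {Δ : Set S}
    (hΔ : MeasurableSet Δ) : CompletelyPositiveFun (μ Δ) :=
  (hμ.1 Δ hΔ).2.1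

theorem IsCPMeasure.hasSum_inner (hμ : IsCPMeasure M μ) (x : X) (ξ η : H) {Δ : ℕ → Set S}
    (hΔ : ∀ i, MeasurableSet (Δ i)) (hd : Pairwise (Function.onFun Disjoint Δ)) :
    HasSum (fun i => ⟪ξ, μ (Δ i) x η⟫_ℂ) ⟪ξ, μ (⋃ i, Δ i) x η⟫_ℂ := by
  have hdiag : ∀ (y : X) (ζ : H), Summable fun i => (⟪ζ, μ (Δ i) (star y * y) ζ⟫_ℂ).re :=
    fun y ζ => Complex.reCLM.summable <|
      summable_of_iUnion_eq_tsum (m := fun Δ => ⟪ζ, μ Δ (star y * y) ζ⟫_ℂ)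
        (fun D h1 h2 => hμ.2 D h1 h2 _ ζ ζ)
        (fun D hD => (hμ.completelyPositiveFun hD).inner_nonneg y ζ) Δ hΔ hd
  have hs : Summable fun i => ⟪ξ, μ (Δ i) x η⟫_ℂ := by
    refine Summable.of_norm_bounded ((hdiag 1 ξ).add (hdiag x η)) fun i => ?_
    have hcp := hμ.completelyPositiveFun (hΔ i)
    have h := hcp.norm_inner_le 1 x ξ η
    rw [star_one, one_mul, one_mul] at h
    have h1 := (Complex.nonneg_iff.1 (hcp.inner_nonneg 1 ξ)).1
    have h2 := (Complex.nonneg_iff.1 (hcp.inner_nonneg x η)).1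
    rw [star_one, one_mul] at h1 ⊢
    nlinarith [Real.sq_sqrt h1, Real.sq_sqrt h2, sq_nonneg (√(⟪ξ, μ (Δ i) 1 ξ⟫_ℂ).re -
      √(⟪η, μ (Δ i) (star x * x) η⟫_ℂ).re)]
  rw [hμ.2 Δ hΔ hd x ξ η]
  exact hs.hasSum

theorem IsCPMeasure.inner_eq_zero_of_null (hμ : IsCPMeasure M μ) {e : ℕ → H}
    (hρ : IsNormalFaithfulStateOn M e) {ν : Measure S} (hν : IsEquivalentBaseMeasure μ e ν)
    (x : X) (ξ η : H) {Δ : Set S} (hΔ : MeasurableSet Δ) (h0 : ν Δ = 0) :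
    ⟪ξ, μ Δ x η⟫_ℂ = 0 := by
  have hcp := hμ.completelyPositiveFun hΔ
  have hnn : ∀ ζ, 0 ≤ ⟪ζ, μ Δ 1 ζ⟫_ℂ := fun ζ => by simpa using hcp.inner_nonneg 1 ζ
  have hpos : (μ Δ 1).IsPositive := by
    rw [ContinuousLinearMap.isPositive_iff_complex]
    intro ζ
    have h := Complex.nonneg_iff.1 (hnn ζ)
    rw [← inner_conj_symm, Complex.conj_eq_iff_im.2 h.2.symm]
    exact ⟨Complex.ext rfl h.2, h.1⟩
  have hone : μ Δ 1 = 0 := hρ.2 _ ((hμ.1 Δ hΔ).2.2 1) hpos ((hν Δ hΔ).1 h0)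
  have h := hcp.norm_inner_le 1 x ξ η
  rw [star_one, one_mul, one_mul, hone] at h
  simpa using h

theorem IsCPMeasure.exists_density (hμ : IsCPMeasure M μ) {e : ℕ → H}
    (hρ : IsNormalFaithfulStateOn M e) {ν : Measure S} [IsFiniteMeasure ν]
    (hν : IsEquivalentBaseMeasure μ e ν) (x : X) (ξ η : H) :
    ∃ g : S → ℂ, Integrable g ν ∧
      ∀ Δ, MeasurableSet Δ → ⟪ξ, μ Δ x η⟫_ℂ = ∫ s in Δ, g s ∂ν :=
  exists_integrable_density ν (fun Δ => ⟪ξ, μ Δ x η⟫_ℂ)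
    (fun _ h1 h2 => hμ.hasSum_inner x ξ η h1 h2)
    (fun _ hΔ h0 => hμ.inner_eq_zero_of_null hρ hν x ξ η hΔ h0)

/-- Matrix coefficients on `π(X) V H` of an operator in the commutant with the defining property
of `κ_μ(f)`. -/
theorem IsKappa.inner_eq {ν : Measure S} {π : X →⋆ₐ[ℂ] (K →L[ℂ] K)} {V : H →L[ℂ] K} {f : S → ℂ}
    {R : K →L[ℂ] K} (hR : IsKappa μ ν π V f R) (hcomm : ∀ x, R * π x = π x * R) {x y : X}
    {ξ η : H} {g : S → ℂ} (hg : Integrable g ν)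
    (hμg : ∀ Δ, MeasurableSet Δ → ⟪ξ, μ Δ (star x * y) η⟫_ℂ = ∫ s in Δ, g s ∂ν) :
    ⟪π x (V ξ), R (π y (V η))⟫_ℂ = ∫ s, f s * g s ∂ν := by
  have h := hR (star x * y) ξ η g hg hμg
  rw [← h, inner_map_apply_eq]
  simp only [ContinuousLinearMap.comp_apply, ContinuousLinearMap.adjoint_inner_right, map_mul,
    mul_apply_eq_comp]
  congr 1
  exact (DFunLike.congr_fun (hcomm (star x)) (π y (V η))).symm

/-- Existence of `κ_μ(f)` with the norm bound by any essential bound of `f`. -/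
theorem IsCPMeasure.exists_isKappa [CStarRing X] [StarModule ℂ X] (hμ : IsCPMeasure M μ) {e : ℕ → H}
    (hρ : IsNormalFaithfulStateOn M e) {ν : Measure S} [IsFiniteMeasure ν]
    (hν : IsEquivalentBaseMeasure μ e ν) {π : X →⋆ₐ[ℂ] (K →L[ℂ] K)} {V : H →L[ℂ] K}
    (hst : IsStinespring (μ Set.univ) π V)
    (hL : (Submodule.span ℂ (Set.range fun p : X × H => π p.1 (V p.2))).topologicalClosure = ⊤)
    {f : S → ℂ} (hf : Measurable f) {C : ℝ} (hC : 0 ≤ C) (hfC : ∀ᵐ s ∂ν, ‖f s‖ ≤ C) :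
    ∃ R : K →L[ℂ] K, (∀ x : X, R * π x = π x * R) ∧ IsKappa μ ν π V f R ∧ ‖R‖ ≤ C := by
  choose g hg hμg using fun (x : X) (ξ η : H) => hμ.exists_density hρ hν x ξ η
  have hLL : ∀ p q : X × H, ⟪π p.1 (V p.2), π q.1 (V q.2)⟫_ℂ =
      ⟪p.2, μ Set.univ (star p.1 * q.1) q.2⟫_ℂ := by
    intro p q
    rw [inner_map_apply_eq, hst, ContinuousLinearMap.comp_apply,
      ContinuousLinearMap.adjoint_inner_right, map_mul]
    rfl
  have hbound := norm_sum_integral_mul_le (ν := ν) (H := H)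
      (k := fun Δ p q => ⟪p.2, μ Δ (star p.1 * q.1) q.2⟫_ℂ)
      (g := fun p q => g (star p.1 * q.1) p.2 q.2)
      (L := fun p : X × H => π p.1 (V p.2))
      (fun p q => hg _ _ _) (fun p q Δ hΔ => hμg _ _ _ Δ hΔ)
      (fun Δ hΔ t => (hμ.completelyPositiveFun hΔ).exists_gram t) hLL hf hC hfC
      (fun p q => (hg _ _ _).bdd_mul hf.aestronglyMeasurable hfC)
  obtain ⟨R, hRC, hR⟩ := exists_clm_of_bounded_kernel _ hL _ hC hbound
  refine ⟨R, fun x => clm_ext_of_inner hL fun p q => ?_, fun x ξ η g' hg' hμg' => ?_, hRC⟩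
  · have h1 := hR p (x * q.1, q.2)
    have h2 := hR (star x * p.1, p.2) q
    simp only [map_mul, mul_apply_eq_comp, star_mul, star_star, mul_assoc] at h1 h2 ⊢
    rw [h1, ← h2, inner_map_apply_eq π (star x), star_star]
  · have h := hR (1, ξ) (x, η)
    simp only [map_one, one_apply_eq_self, star_one, one_mul] at h
    simp only [ContinuousLinearMap.comp_apply, ContinuousLinearMap.adjoint_inner_right]
    rw [h]
    have hae : g x ξ η =ᵐ[ν] g' := (hg x ξ η).ae_eq_of_forall_setIntegral_eq _ _ hg'
      fun Δ hΔ _ => by rw [← hμg x ξ η Δ hΔ, hμg' Δ hΔ]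
    exact integral_congr_ae (hae.mono fun s hs => by simp only [hs])

end CPMeasure

/-- For a CP-measure space `(S, F, μ)` with barycenter `T = μ(S)` and `ν` a finite
measure equivalent to `ρ ∘ μ` for a normal faithful state `ρ` on `M`, every
`f ∈ L^∞(ν)` determines a unique `κ_μ(f) ∈ π_T(X)′` with
`V* κ_μ(f) π(x) V = ∫ f(s) dμ(s, x)` weakly, and `‖κ_μ(f)‖ ≤ ‖f‖_∞`. -/
theorem kappa_exists_unique
    {X : Type*} [NormedRing X] [StarRing X] [CStarRing X]
    [NormedAlgebra ℂ X] [StarModule ℂ X]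
    {H K : Type*} [NormedAddCommGroup H] [InnerProductSpace ℂ H] [CompleteSpace H]
    [NormedAddCommGroup K] [InnerProductSpace ℂ K] [CompleteSpace K]
    {S : Type*} [MeasurableSpace S]
    (M : VonNeumannAlgebra H) (μ : Set S → X → (H →L[ℂ] H))
    (hμ : IsCPMeasure M μ)
    (e : ℕ → H) (hρ : IsNormalFaithfulStateOn M e)
    (ν : MeasureTheory.Measure S) [MeasureTheory.IsFiniteMeasure ν]
    (hν : IsEquivalentBaseMeasure μ e ν)
    (π : X →⋆ₐ[ℂ] (K →L[ℂ] K)) (V : H →L[ℂ] K)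
    (hst : IsStinespring (μ Set.univ) π V) (hmin : IsMinimalStinespring π V) :
    ∀ f : S → ℂ, Measurable f → (∃ C : ℝ, ∀ s, ‖f s‖ ≤ C) →
      (∃! R : K →L[ℂ] K, (∀ x : X, R * π x = π x * R) ∧ IsKappa μ ν π V f R) ∧
      (∀ R : K →L[ℂ] K, (∀ x : X, R * π x = π x * R) → IsKappa μ ν π V f R →
        (‖R‖₊ : ENNReal) ≤ MeasureTheory.eLpNorm f ⊤ ν) := by
  intro f hf ⟨B, hB⟩
  have hL : (Submodule.span ℂ
      (Set.range fun p : X × H => π p.1 (V p.2))).topologicalClosure = ⊤ := by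
    rw [← hmin]
    congr 2
    ext k
    simp [eq_comm]
  have htop : eLpNorm f ⊤ ν ≠ ⊤ :=
    (memLp_top_of_bound hf.aestronglyMeasurable B (Eventually.of_forall hB)).eLpNorm_ne_top
  have hfC : ∀ᵐ s ∂ν, ‖f s‖ ≤ (eLpNorm f ⊤ ν).toReal := by
    rw [eLpNorm_exponent_top] at htop ⊢
    filter_upwards [enorm_ae_le_eLpNormEssSup f ν] with s hs
    simpa using ENNReal.toReal_mono htop hs
  have huniq : ∀ R R' : K →L[ℂ] K, (∀ x : X, R * π x = π x * R) → IsKappa μ ν π V f R →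
      (∀ x : X, R' * π x = π x * R') → IsKappa μ ν π V f R' → R = R' := by
    intro R R' hc hR hc' hR'
    refine clm_ext_of_inner hL fun p q => ?_
    obtain ⟨g, hg, hμg⟩ := hμ.exists_density hρ hν (star p.1 * q.1) p.2 q.2
    rw [hR.inner_eq hc hg hμg, hR'.inner_eq hc' hg hμg]
  obtain ⟨R, hc, hR, hRC⟩ := hμ.exists_isKappa hρ hν hst hL hf ENNReal.toReal_nonneg hfC
  refine ⟨⟨R, ⟨hc, hR⟩, fun R' h => huniq R' R h.1 h.2 hc hR⟩, fun R' hc' hR' => ?_⟩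
  rw [huniq R' R hc' hR' hc hR, ← ENNReal.ofReal_toReal htop, ← ENNReal.ofReal_coe_nnreal]
  exact ENNReal.ofReal_le_ofReal hRC
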